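/- arXiv:1912.08906 — 2 statements merged into one kernel-verified Lean document; each statement's English description precedes it below -/
import Mathlib

section
/- Let p be an odd prime and let G be a quasi-powerful p-group with d(G) = r. Then every subgroup H of G satisfies d(H) ≤ r(r+3)/2. -/
/-- The subgroup of `G` generated by all `n`-th powers. -/
def powSubgroup (G : Type*) [Group G] (n : ℕ) : Subgroup G :=
  Subgroup.closure {x : G | ∃ g : G, g ^ n = x}

/-- `Ω_k`-type subgroup: generated by all elements whose `n`-th power is trivial. -/
def omegaSubgroup (G : Type*) [Group G] (n : ℕ) : Subgroup G :=
  Subgroup.closure {g : G | g ^ n = 1}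

/-- A group is powerful (for a prime `p`) if `[G,G] ≤ G^p`. -/
def IsPowerful (p : ℕ) (G : Type*) [Group G] : Prop :=
  commutator G ≤ powSubgroup G p

/-- A group is quasi-powerful (for a prime `p`) if `G/Z(G)` is powerful. -/
def IsQuasiPowerful (p : ℕ) (G : Type*) [Group G] : Prop :=
  IsPowerful p (G ⧸ Subgroup.center G)

/-- The commutator `[x,y] = x⁻¹y⁻¹xy`. -/
def pcomm {G : Type*} [Group G] (a b : G) : G := a⁻¹ * b⁻¹ * a * b

open Subgroup
open scoped commutatorElement

lemma mul_pow_of_mul_eq_central_mul {G : Type*} [Group G] {x c z : G} (hz : z ∈ center G)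
    (h : x * c = z * c * x) (n : ℕ) : (c * x) ^ n = z ^ n.choose 2 * c ^ n * x ^ n := by
  have hzc : ∀ (k : ℕ) (g : G), g * z ^ k = z ^ k * g := fun k g =>
    mem_center_iff.mp (pow_mem hz k) g
  have hx : ∀ n : ℕ, x ^ n * c = z ^ n * c * x ^ n := by
    intro n
    induction n with
    | zero => simp
    | succ n ih =>
      calc x ^ (n + 1) * c = x ^ n * (x * c) := by rw [pow_succ, mul_assoc]
        _ = x ^ n * z ^ 1 * c * x := by rw [h]; group
        _ = z * (x ^ n * c) * x := by rw [hzc]; group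
        _ = z ^ (n + 1) * c * x ^ (n + 1) := by rw [ih]; group
  induction n with
  | zero => simp
  | succ n ih =>
    have hch : (n + 1).choose 2 = n.choose 2 + n := by
      rw [Nat.choose_succ_succ' n 1, Nat.choose_one_right, add_comm]
    calc (c * x) ^ (n + 1) = z ^ n.choose 2 * c ^ n * (x ^ n * c) * x := by
          rw [pow_succ, ih]; group
      _ = z ^ n.choose 2 * (c ^ n * z ^ n) * c * x ^ n * x := by rw [hx]; group
      _ = z ^ (n + 1).choose 2 * c ^ (n + 1) * x ^ (n + 1) := by
          rw [hzc, hch, pow_add, pow_succ c, pow_succ x]; group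

lemma mul_pow_prime_of_mul_eq_central_mul {p : ℕ} (hp : p.Prime) (hodd : Odd p)
    {G : Type*} [Group G] {x c z : G} (hz : z ∈ center G) (hzp : z ^ p = 1)
    (h : x * c = z * c * x) : (c * x) ^ p = c ^ p * x ^ p := by
  have h2 : 2 < p := lt_of_le_of_ne hp.two_le fun h => by subst h; exact absurd hodd (by decide)
  obtain ⟨k, hk⟩ := hp.dvd_choose_self two_ne_zero h2
  rw [mul_pow_of_mul_eq_central_mul hz h, hk, pow_mul, hzp, one_pow, one_mul]

lemma pow_mem_powSubgroup {G : Type*} [Group G] (n : ℕ) (g : G) : g ^ n ∈ powSubgroup G n :=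
  subset_closure ⟨g, rfl⟩

lemma map_powSubgroup {G G' : Type*} [Group G] [Group G'] {f : G →* G'}
    (hf : Function.Surjective f) (n : ℕ) : (powSubgroup G n).map f = powSubgroup G' n := by
  rw [powSubgroup, MonoidHom.map_closure, powSubgroup]
  congr 1
  ext y
  constructor
  · rintro ⟨_, ⟨g, rfl⟩, rfl⟩
    exact ⟨f g, (map_pow f g n).symm⟩
  · rintro ⟨g, rfl⟩
    obtain ⟨x, rfl⟩ := hf g
    exact ⟨x ^ n, ⟨x, rfl⟩, map_pow f x n⟩

instance powSubgroup_characteristic (G : Type*) [Group G] (n : ℕ) :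
    (powSubgroup G n).Characteristic :=
  characteristic_iff_map_eq.mpr fun e => map_powSubgroup e.surjective n

lemma IsPowerful.of_surjective {p : ℕ} {G G' : Type*} [Group G] [Group G'] (hG : IsPowerful p G)
    {f : G →* G'} (hf : Function.Surjective f) : IsPowerful p G' := by
  have h := map_mono (f := f) hG
  rwa [map_powSubgroup hf, commutator_def, map_commutator, map_top_of_surjective f hf] at h

lemma IsPowerful.commutatorElement_mem {p : ℕ} {G : Type*} [Group G] (hG : IsPowerful p G)
    (a b : G) : ⁅a, b⁆ ∈ powSubgroup G p :=
  hG (commutator_mem_commutator (mem_top a) (mem_top b))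

lemma IsPowerful.powSubgroup_le_center_of_commutator_le_center {p : ℕ} (hp : p.Prime)
    (hodd : Odd p) {G : Type*} [Group G] (hG : IsPowerful p G)
    (hexp : ∀ x ∈ powSubgroup G p, x ^ p = 1)
    (hcen : ⁅powSubgroup G p, ⊤⁆ ≤ center G) : powSubgroup G p ≤ center G := by
  rw [powSubgroup, closure_le]
  rintro _ ⟨x, rfl⟩
  refine mem_center_iff.mpr fun g => ?_
  have hc := hG.commutatorElement_mem g x
  have hz : ⁅x, ⁅g, x⁆⁆ ∈ center G := hcen (by
    rw [commutator_comm]; exact commutator_mem_commutator (mem_top x) hc)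
  have h := mul_pow_prime_of_mul_eq_central_mul hp hodd (x := x) (c := ⁅g, x⁆) hz
    (hexp _ (hG.commutatorElement_mem _ _)) (by simp [commutatorElement_def, mul_assoc])
  rw [hexp _ hc, one_mul] at h
  have h2 : ⁅g, x⁆ * x = g * x * g⁻¹ := by simp [commutatorElement_def]
  rw [h2, conj_pow] at h
  exact mul_inv_eq_iff_eq_mul.mp h

lemma IsPowerful.powSubgroup_le_center {p : ℕ} (hp : p.Prime)
    (hodd : Odd p) {G : Type*} [Group G] [Group.IsNilpotent G] (hG : IsPowerful p G)
    (hexp : ∀ x ∈ powSubgroup G p, x ^ p = 1) : powSubgroup G p ≤ center G := by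
  set Y : Subgroup G := ⁅powSubgroup G p, ⊤⁆ with hY
  have hYY : Y ≤ ⁅Y, ⊤⁆ := by
    let f := QuotientGroup.mk' ⁅Y, (⊤ : Subgroup G)⁆
    have hf : Function.Surjective f := QuotientGroup.mk'_surjective _
    have hker : f.ker = ⁅Y, (⊤ : Subgroup G)⁆ := QuotientGroup.ker_mk' _
    have hcen := (hG.of_surjective hf).powSubgroup_le_center_of_commutator_le_center hp hodd
      (by
        rw [← map_powSubgroup hf]
        rintro _ ⟨x, hx, rfl⟩
        rw [← map_pow, hexp x hx, map_one])
      (by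
        rw [← map_powSubgroup hf, ← map_top_of_surjective f hf, ← map_commutator, ← hY,
          ← commutator_top_right_eq_bot_iff_le_center, ← map_top_of_surjective f hf,
          ← map_commutator, Subgroup.map_eq_bot_iff, hker])
    rw [← commutator_top_right_eq_bot_iff_le_center, ← map_powSubgroup hf,
      ← map_top_of_surjective f hf, ← map_commutator, Subgroup.map_eq_bot_iff, hker] at hcen
    exact hcen
  have hlow : ∀ n, Y ≤ (⊤ : Subgroup G).lowerCentralSeries n := by
    intro n
    induction n with
    | zero => exact le_top
    | succ n ih => exact hYY.trans (commutator_mono ih le_rfl)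
  obtain ⟨n, hn⟩ := Subgroup.nilpotent_iff_lowerCentralSeries.mp ‹_›
  exact commutator_top_right_eq_bot_iff_le_center.mp (le_bot_iff.mp (hn ▸ hlow n))

/-- The image of `G^[p]^[p]` in `G`. -/
abbrev powPowSubgroup (p : ℕ) (G : Type*) [Group G] : Subgroup G :=
  (powSubgroup (powSubgroup G p) p).map (powSubgroup G p).subtype

instance (p : ℕ) (G : Type*) [Group G] : (powPowSubgroup p G).Normal :=
  ConjAct.normal_of_characteristic_of_normal

lemma IsPowerful.powSubgroup_quotient_le_center {p : ℕ} (hp : p.Prime) (hodd : Odd p)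
    {G : Type*} [Group G] [Group.IsNilpotent G] (hG : IsPowerful p G) :
    powSubgroup (G ⧸ powPowSubgroup p G) p ≤ center (G ⧸ powPowSubgroup p G) := by
  have hf := QuotientGroup.mk'_surjective (powPowSubgroup p G)
  refine (hG.of_surjective hf).powSubgroup_le_center hp hodd ?_
  rw [← map_powSubgroup hf]
  rintro _ ⟨x, hx, rfl⟩
  rw [← map_pow]
  exact (QuotientGroup.eq_one_iff _).mpr
    ⟨⟨x, hx⟩ ^ p, pow_mem_powSubgroup p (⟨x, hx⟩ : powSubgroup G p), rfl⟩

lemma IsPowerful.isPowerful_powSubgroup {p : ℕ} (hp : p.Prime) (hodd : Odd p) {G : Type*} [Group G]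
    [Group.IsNilpotent G] (hG : IsPowerful p G) : IsPowerful p (powSubgroup G p) := by
  have h := hG.powSubgroup_quotient_le_center hp hodd
  have hf := QuotientGroup.mk'_surjective (powPowSubgroup p G)
  rw [← commutator_top_right_eq_bot_iff_le_center, ← map_powSubgroup hf,
    ← map_top_of_surjective _ hf, ← map_commutator, Subgroup.map_eq_bot_iff,
    QuotientGroup.ker_mk'] at h
  rw [IsPowerful, ← map_le_map_iff_of_injective (subtype_injective (powSubgroup G p)),
    commutator_def, map_commutator, ← MonoidHom.range_eq_map, range_subtype]
  exact (commutator_mono le_rfl le_top).trans h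

lemma IsPowerful.exists_powHom {p : ℕ} (hp : p.Prime) (hodd : Odd p) {G : Type*} [Group G]
    [Group.IsNilpotent G] (hG : IsPowerful p G) :
    ∃ f : G →* G ⧸ powPowSubgroup p G, ∀ x, f x = QuotientGroup.mk' _ (x ^ p) := by
  have hcen := hG.powSubgroup_quotient_le_center hp hodd
  have hf := QuotientGroup.mk'_surjective (powPowSubgroup p G)
  have hz : ∀ x y : G, ⁅QuotientGroup.mk' (powPowSubgroup p G) y,
      QuotientGroup.mk' (powPowSubgroup p G) x⁆ ^ p = 1 := by
    intro x y
    rw [← map_commutatorElement, ← map_pow]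
    exact (QuotientGroup.eq_one_iff _).mpr ⟨⟨⁅y, x⁆, hG.commutatorElement_mem y x⟩ ^ p,
      pow_mem_powSubgroup p (⟨⁅y, x⁆, hG.commutatorElement_mem y x⟩ : powSubgroup G p), rfl⟩
  refine ⟨⟨⟨fun x => QuotientGroup.mk' _ (x ^ p), by simp⟩, fun x y => ?_⟩, fun x => rfl⟩
  simp only [map_pow, map_mul]
  exact mul_pow_prime_of_mul_eq_central_mul hp hodd
    (hcen ((hG.of_surjective hf).commutatorElement_mem _ _)) (hz x y)
    (by simp [commutatorElement_def, mul_assoc])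

/-- The subgroup of `G` generated by the commutators and `p`-th powers of elements of `H`. -/
def commPowSubgroup (p : ℕ) {G : Type*} [Group G] (H : Subgroup G) : Subgroup G :=
  ⁅H, H⁆ ⊔ closure ((· ^ p) '' (H : Set G))

lemma commPowSubgroup_le_iff {p : ℕ} {G : Type*} [Group G] {H L : Subgroup G} :
    commPowSubgroup p H ≤ L ↔ ⁅H, H⁆ ≤ L ∧ ∀ x ∈ H, x ^ p ∈ L := by
  rw [commPowSubgroup, sup_le_iff, closure_le, Set.image_subset_iff]
  rfl

lemma pow_mem_commPowSubgroup {p : ℕ} {G : Type*} [Group G] {H : Subgroup G} {x : G}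
    (hx : x ∈ H) : x ^ p ∈ commPowSubgroup p H :=
  (commPowSubgroup_le_iff.mp le_rfl).2 x hx

lemma map_commPowSubgroup {p : ℕ} {G G' : Type*} [Group G] [Group G'] (f : G →* G')
    (H : Subgroup G) : (commPowSubgroup p H).map f = commPowSubgroup p (H.map f) := by
  rw [commPowSubgroup, commPowSubgroup, Subgroup.map_sup, map_commutator, MonoidHom.map_closure]
  congr 2
  ext y
  simp

lemma commPowSubgroup_mono {p : ℕ} {G : Type*} [Group G] {H K : Subgroup G} (h : H ≤ K) :
    commPowSubgroup p H ≤ commPowSubgroup p K :=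
  sup_le_sup (commutator_mono h h) (closure_mono (Set.image_mono h))

instance commPowSubgroup_top_normal (p : ℕ) (G : Type*) [Group G] :
    (commPowSubgroup p (⊤ : Subgroup G)).Normal :=
  Subgroup.Normal.of_commutator_le G le_sup_left

lemma IsPowerful.commPowSubgroup_top_le {p : ℕ} {G : Type*} [Group G] (hG : IsPowerful p G) :
    commPowSubgroup p (⊤ : Subgroup G) ≤ powSubgroup G p :=
  commPowSubgroup_le_iff.mpr ⟨hG, fun x _ => pow_mem_powSubgroup p x⟩

lemma powSubgroup_le_commPowSubgroup_top (p : ℕ) (G : Type*) [Group G] :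
    powSubgroup G p ≤ commPowSubgroup p ⊤ := by
  rw [powSubgroup, closure_le]
  rintro _ ⟨x, rfl⟩
  exact pow_mem_commPowSubgroup (mem_top x)

lemma IsPGroup.eq_top_of_sup_commPowSubgroup_eq_top {p : ℕ} (hp : p.Prime) {G : Type*} [Group G]
    [Finite G] (hG : IsPGroup p G) {L : Subgroup G} (h : L ⊔ commPowSubgroup p ⊤ = ⊤) :
    L = ⊤ := by
  have : Fact p.Prime := ⟨hp⟩
  by_contra hL
  obtain ⟨n, hn⟩ := IsPGroup.iff_card.mp hG
  obtain ⟨k, hk⟩ := IsPGroup.iff_card.mp (hG.to_subgroup L)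
  have hlt : Nat.card L < Nat.card G :=
    lt_of_le_of_ne (card_le_card_group L) fun h => hL (L.eq_top_of_card_eq h)
  rw [hn, hk, Nat.pow_lt_pow_iff_right hp.one_lt] at hlt
  obtain ⟨n, rfl⟩ := Nat.exists_eq_succ_of_ne_zero (Nat.ne_zero_of_lt hlt)
  obtain ⟨M, hM, hLM⟩ := Sylow.exists_subgroup_card_pow_prime_le p (m := n)
    (hn ▸ pow_dvd_pow p n.le_succ) L hk (Nat.lt_succ_iff.mp hlt)
  have hidx : M.index = p := by
    have h1 := M.card_mul_index
    rw [hM, hn, pow_succ] at h1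
    exact Nat.eq_of_mul_eq_mul_left (pow_pos hp.pos n) h1
  have : M.Normal := normal_of_index_eq_minFac_card (by
    rw [hidx, hn, Nat.pow_minFac n.succ_ne_zero, hp.minFac_eq])
  have hcard : Nat.card (G ⧸ M) = p := hidx
  have hle : commPowSubgroup p (⊤ : Subgroup G) ≤ M := by
    refine commPowSubgroup_le_iff.mpr ⟨?_, fun x _ => ?_⟩
    · have := isCyclic_of_prime_card hcard
      exact Normal.quotient_commutative_iff_commutator_le.mp inferInstance
    · rw [← QuotientGroup.eq_one_iff, QuotientGroup.mk_pow, ← hcard, pow_card_eq_one']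
  have hMtop : M = ⊤ := top_le_iff.mp (h ▸ sup_le hLM hle)
  rw [hMtop, index_top] at hidx
  exact hp.one_lt.ne hidx

theorem IsPowerful.card_le_card_commPowSubgroup_mul_index {p : ℕ} (hp : p.Prime) (hodd : Odd p)
    {G : Type*} [Group G] [Finite G] (hpG : IsPGroup p G) (hG : IsPowerful p G)
    (H : Subgroup G) :
    Nat.card H ≤ Nat.card (commPowSubgroup p H) * (powSubgroup G p).index := by
  have : Fact p.Prime := ⟨hp⟩
  have : Group.IsNilpotent G := hpG.isNilpotent
  induction hn : Nat.card G using Nat.strong_induction_on generalizing G with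
  | _ n ih =>
  subst hn
  rcases subsingleton_or_nontrivial G with hs | hs
  · rw [Nat.card_of_subsingleton (1 : H)]
    exact Nat.mul_pos Nat.card_pos (Nat.pos_of_ne_zero FiniteIndex.index_ne_zero)
  set P := powSubgroup G p with hP
  have hPtop : P ≠ ⊤ := by
    intro h
    have h1 : (⊥ : Subgroup G) = ⊤ := hpG.eq_top_of_sup_commPowSubgroup_eq_top hp
      (top_le_iff.mp (h.ge.trans ((powSubgroup_le_commPowSubgroup_top p G).trans le_sup_right)))
    exact bot_ne_top h1
  have hPpow : IsPowerful p P := hG.isPowerful_powSubgroup hp hodd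
  have hlt : Nat.card P < Nat.card G :=
    lt_of_le_of_ne (card_le_card_group P) fun h => hPtop (P.eq_top_of_card_eq h)
  obtain ⟨f, hf⟩ := hG.exists_powHom hp hodd
  set M := powPowSubgroup p G with hM
  set mk := QuotientGroup.mk' M with hmk
  have hker : mk.ker = M := QuotientGroup.ker_mk' M
  set T := f.ker with hT
  have hPT : P ≤ T := by
    intro x hx
    rw [hT, MonoidHom.mem_ker, hf]
    exact (QuotientGroup.eq_one_iff _).mpr
      ⟨⟨x, hx⟩ ^ p, pow_mem_powSubgroup p (⟨x, hx⟩ : P), rfl⟩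
  have hsub : (H.subgroupOf P).map P.subtype = H ⊓ P := subgroupOf_map_subtype H P
  have hIH : Nat.card (H ⊓ P : Subgroup G) ≤
      Nat.card (commPowSubgroup p (H ⊓ P)) * M.relIndex P := by
    have h1 := ih _ hlt (hpG.to_subgroup P) hPpow (H.subgroupOf P) inferInstance rfl
    rw [← hsub, ← map_commPowSubgroup, card_map_of_injective P.subtype_injective,
      card_map_of_injective P.subtype_injective, relIndex,
      show M.subgroupOf P = _ from comap_map_eq_self_of_injective P.subtype_injective _]
    exact h1
  have hMT : M.relIndex P ≤ T.index := by
    rw [hT, index_ker, ← hker, relIndex_ker]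
    refine card_le_of_le ?_
    rw [hP, powSubgroup, map_le_iff_le_comap, closure_le]
    rintro _ ⟨x, rfl⟩
    exact ⟨x, hf x⟩
  have hPhi : Nat.card (commPowSubgroup p (H ⊓ P)) * T.relIndex H ≤
      Nat.card (commPowSubgroup p H) := by
    have h1 : commPowSubgroup p (H ⊓ P) ≤ commPowSubgroup p H ⊓ M := by
      refine le_inf (commPowSubgroup_mono inf_le_left) ?_
      rw [← hsub, ← map_commPowSubgroup]
      exact map_mono ((commPowSubgroup_mono le_top).trans hPpow.commPowSubgroup_top_le)
    have h2 : T.relIndex H ≤ M.relIndex (commPowSubgroup p H) := by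
      rw [hT, relIndex_ker, ← hker, relIndex_ker]
      refine card_le_of_le ?_
      rintro _ ⟨x, hx, rfl⟩
      exact ⟨x ^ p, pow_mem_commPowSubgroup hx, (hf x).symm⟩
    have h3 := relIndex_mul_relIndex ⊥ (commPowSubgroup p H ⊓ M) (commPowSubgroup p H) bot_le
      inf_le_left
    rw [relIndex_bot_left, relIndex_bot_left, inf_relIndex_left] at h3
    rw [← h3]
    exact Nat.mul_le_mul (card_le_of_le h1) h2
  have hH : Nat.card (H ⊓ P : Subgroup G) * (P.relIndex (H ⊓ T) * T.relIndex H) = Nat.card H := by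
    have h1 := relIndex_mul_relIndex (H ⊓ P) (H ⊓ T) H (inf_le_inf_left H hPT) inf_le_left
    have h2 := relIndex_mul_relIndex ⊥ (H ⊓ P) H bot_le inf_le_left
    rw [relIndex_bot_left, relIndex_bot_left, ← h1, inf_relIndex_left] at h2
    have h3 : (H ⊓ P).relIndex (H ⊓ T) = P.relIndex (H ⊓ T) := by
      rw [← inf_relIndex_right P, ← inf_relIndex_right (H ⊓ P)]
      congr 1
      ext x
      simp only [mem_inf]
      tauto
    rw [← h3, h2]
  have hrel : P.relIndex (H ⊓ T) ≤ P.relIndex T :=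
    relIndex_le_of_le_right inf_le_right FiniteIndex.index_ne_zero
  calc Nat.card H = Nat.card (H ⊓ P : Subgroup G) * (P.relIndex (H ⊓ T) * T.relIndex H) := hH.symm
    _ ≤ (Nat.card (commPowSubgroup p (H ⊓ P)) * T.index) * (P.relIndex T * T.relIndex H) :=
      Nat.mul_le_mul (hIH.trans (Nat.mul_le_mul_left _ hMT)) (Nat.mul_le_mul_right _ hrel)
    _ = (Nat.card (commPowSubgroup p (H ⊓ P)) * T.relIndex H) * (P.relIndex T * T.index) := by ring
    _ ≤ Nat.card (commPowSubgroup p H) * P.index := by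
      rw [relIndex_mul_index hPT]
      exact Nat.mul_le_mul_right _ hPhi

lemma exists_finset_card_le_of_surjective {G G' : Type*} [Group G] [Group G'] [Group.FG G']
    {f : G →* G'} (hf : Function.Surjective f) :
    ∃ S : Finset G, S.card ≤ Group.rank G' ∧ closure (S : Set G) ⊔ f.ker = ⊤ := by
  classical
  obtain ⟨S, hS, hcl⟩ := Group.rank_spec G'
  refine ⟨S.image (Function.surjInv hf), Finset.card_image_le.trans hS.le, ?_⟩
  rw [← comap_map_eq, MonoidHom.map_closure, Finset.coe_image, Set.image_image]
  simp [Function.surjInv_eq hf, hcl]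

lemma rank_le_rank_range_add_rank_ker {G G' : Type*} [Group G] [Finite G] [Group G']
    (f : G →* G') : Group.rank G ≤ Group.rank f.range + Group.rank f.ker := by
  classical
  obtain ⟨S, hS, hcl⟩ := exists_finset_card_le_of_surjective f.rangeRestrict_surjective
  obtain ⟨T, hT, hTcl⟩ := Group.rank_spec f.ker
  rw [MonoidHom.ker_rangeRestrict] at hcl
  have hker : closure ((T.image f.ker.subtype : Finset G) : Set G) = f.ker := by
    rw [Finset.coe_image, ← MonoidHom.map_closure, hTcl, ← MonoidHom.range_eq_map, range_subtype]
  calc Group.rank G ≤ (S ∪ T.image f.ker.subtype).card := by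
        refine Group.rank_le ?_
        rw [Finset.coe_union, Subgroup.closure_union, hker, hcl]
    _ ≤ _ := (Finset.card_union_le _ _).trans
        (Nat.add_le_add hS (Finset.card_image_le.trans hT.le))

lemma IsPGroup.pow_rank_le_card {p : ℕ} (hp : p.Prime) {G : Type*} [Group G] [Finite G]
    (hG : IsPGroup p G) : p ^ Group.rank G ≤ Nat.card G := by
  classical
  have : Fact p.Prime := ⟨hp⟩
  have key : ∀ k : ℕ, ∃ S : Finset G, S.card ≤ k ∧
      (closure (S : Set G) = ⊤ ∨ p ^ k ≤ Nat.card (closure (S : Set G))) := by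
    intro k
    induction k with
    | zero => exact ⟨∅, le_rfl, Or.inr Nat.card_pos⟩
    | succ k ih =>
      obtain ⟨S, hS, h⟩ := ih
      by_cases htop : closure (S : Set G) = ⊤
      · exact ⟨S, hS.trans k.le_succ, Or.inl htop⟩
      replace h := h.resolve_left htop
      obtain ⟨x, hx⟩ : ∃ x, x ∉ closure (S : Set G) := by
        by_contra! hall
        exact htop (eq_top_iff.mpr fun x _ => hall x)
      refine ⟨insert x S, (Finset.card_insert_le x S).trans (Nat.succ_le_succ hS), Or.inr ?_⟩
      obtain ⟨a, ha⟩ := IsPGroup.iff_card.mp (hG.to_subgroup (closure (S : Set G)))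
      obtain ⟨b, hb⟩ := IsPGroup.iff_card.mp
        (hG.to_subgroup (closure ((insert x S : Finset G) : Set G)))
      have hle : closure (S : Set G) ≤ closure ((insert x S : Finset G) : Set G) :=
        closure_mono (by simp)
      have hne : Nat.card (closure (S : Set G)) ≠
          Nat.card (closure ((insert x S : Finset G) : Set G)) := by
        intro heq
        apply hx
        rw [eq_of_le_of_card_ge hle heq.ge]
        exact subset_closure (by simp)
      have hlt := lt_of_le_of_ne (card_le_of_le hle) hne
      rw [ha, hb, Nat.pow_lt_pow_iff_right hp.one_lt] at hlt
      rw [ha, Nat.pow_le_pow_iff_right hp.one_lt] at h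
      rw [hb]
      exact Nat.pow_le_pow_right hp.pos (h.trans_lt hlt)
  obtain ⟨n, hn⟩ := IsPGroup.iff_card.mp hG
  obtain ⟨S, hS, h⟩ := key n
  have htop : closure (S : Set G) = ⊤ :=
    h.elim id fun h => eq_top_of_le_card _ (hn.trans_le h)
  rw [hn]
  exact Nat.pow_le_pow_right hp.pos ((Group.rank_le htop).trans hS)

lemma IsPGroup.pow_rank_mul_card_le_card {p : ℕ} (hp : p.Prime) {G : Type*} [Group G] [Finite G]
    (hG : IsPGroup p G) :
    p ^ Group.rank G * Nat.card (commPowSubgroup p (⊤ : Subgroup G)) ≤ Nat.card G := by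
  obtain ⟨S, hS, hcl⟩ := exists_finset_card_le_of_surjective
    (QuotientGroup.mk'_surjective (commPowSubgroup p (⊤ : Subgroup G)))
  rw [QuotientGroup.ker_mk'] at hcl
  have h1 := Group.rank_le (hG.eq_top_of_sup_commPowSubgroup_eq_top hp hcl)
  rw [card_eq_card_quotient_mul_card_subgroup (commPowSubgroup p (⊤ : Subgroup G))]
  exact Nat.mul_le_mul_right _ ((Nat.pow_le_pow_right hp.pos (h1.trans hS)).trans
    ((hG.to_quotient _).pow_rank_le_card hp))

lemma IsPowerful.index_powSubgroup_le {p : ℕ} (hp : p.Prime) {G : Type*} [Group G] [Finite G]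
    (hG : IsPowerful p G) : (powSubgroup G p).index ≤ p ^ Group.rank G := by
  have hcomm : IsMulCommutative (G ⧸ powSubgroup G p) :=
    Normal.quotient_commutative_iff_commutator_le.mpr hG
  let _ : CommGroup (G ⧸ powSubgroup G p) :=
    { (inferInstance : Group (G ⧸ powSubgroup G p)) with
      mul_comm := fun a b => hcomm.is_comm.comm a b }
  have hdvd := card_dvd_exponent_pow_rank' (G ⧸ powSubgroup G p) (n := p) (by
    intro x
    obtain ⟨g, rfl⟩ := QuotientGroup.mk_surjective x
    rw [← QuotientGroup.mk_pow]
    exact (QuotientGroup.eq_one_iff _).mpr (pow_mem_powSubgroup p g))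
  exact (Nat.le_of_dvd (pow_pos hp.pos _) hdvd).trans (Nat.pow_le_pow_right hp.pos
    (Group.rank_le_of_surjective (QuotientGroup.mk' _) (QuotientGroup.mk'_surjective _)))

theorem IsPowerful.rank_subgroup_le {p : ℕ} (hp : p.Prime) (hodd : Odd p) {G : Type*} [Group G]
    [Finite G] (hpG : IsPGroup p G) (hG : IsPowerful p G) (H : Subgroup G) :
    Group.rank H ≤ Group.rank G := by
  have h1 := (hpG.to_subgroup H).pow_rank_mul_card_le_card hp
  rw [← card_map_of_injective H.subtype_injective, map_commPowSubgroup, ← MonoidHom.range_eq_map,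
    range_subtype] at h1
  have h2 := h1.trans (hG.card_le_card_commPowSubgroup_mul_index hp hodd hpG H)
  rw [mul_comm] at h2
  exact (Nat.pow_le_pow_iff_right hp.one_lt).mp
    ((Nat.le_of_mul_le_mul_left h2 Nat.card_pos).trans (hG.index_powSubgroup_le hp))

lemma isPowerful_of_isMulCommutative (p : ℕ) (G : Type*) [Group G] [IsMulCommutative G] :
    IsPowerful p G := by
  rw [IsPowerful, commutator_def, commutator_le]
  intro a _ b _
  rw [commutatorElement_eq_one_iff_mul_comm.mpr (mul_comm' a b)]
  exact one_mem _

lemma IsQuasiPowerful.exists_commutatorElement_mul_mem {p : ℕ} {G : Type*} [Group G]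
    (hG : IsQuasiPowerful p G) (a b : G) : ∃ z ∈ center G, ⁅a, b⁆ * z ∈ powSubgroup G p := by
  have hf := QuotientGroup.mk'_surjective (center G)
  have h := hG.commutatorElement_mem (QuotientGroup.mk' _ a) (QuotientGroup.mk' _ b)
  rw [← map_powSubgroup hf, ← map_commutatorElement] at h
  obtain ⟨q, hq, hqe⟩ := h
  refine ⟨⁅a, b⁆⁻¹ * q, QuotientGroup.eq.mp hqe.symm, by rwa [mul_inv_cancel_left]⟩

/-- A quasi-powerful group of rank `r` has a central subgroup of rank at most `r (r + 1) / 2`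
with powerful quotient. -/
lemma IsQuasiPowerful.exists_le_center {p : ℕ} {G : Type*} [Group G] [Finite G]
    (hG : IsQuasiPowerful p G) : ∃ (N : Subgroup G) (_ : N.Normal), N ≤ center G ∧
      Group.rank N ≤ (Group.rank G + 1).choose 2 ∧ IsPowerful p (G ⧸ N) := by
  classical
  obtain ⟨S, hS, hcl⟩ := Group.rank_spec G
  choose z hz hzm using hG.exists_commutatorElement_mul_mem
  let w : Sym2 G → G := fun s => z s.out.1 s.out.2
  set T : Finset G := S.sym2.image w with hT
  have hTc : closure (T : Set G) ≤ center G := by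
    rw [closure_le]
    intro x hx
    obtain ⟨s, -, rfl⟩ := Finset.mem_image.mp (Finset.mem_coe.mp hx)
    exact hz _ _
  have hN : (closure (T : Set G)).Normal :=
    ⟨fun x hx g => by rwa [mem_center_iff.mp (hTc hx) g, mul_inv_cancel_right]⟩
  refine ⟨closure T, hN, hTc, ?_, ?_⟩
  · rw [← hS, ← Finset.card_sym2]
    exact (rank_closure_finset_le_card T).trans Finset.card_image_le
  set W : Subgroup G := powSubgroup G p ⊔ closure (T : Set G) with hW
  have hcomm : ∀ a ∈ S, ∀ b ∈ S, ⁅a, b⁆ ∈ W := by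
    intro a ha b hb
    have hout : ⁅(s(a, b)).out.1, (s(a, b)).out.2⁆ ∈ W := by
      have h1 : w s(a, b) ∈ W := (le_sup_right : _ ≤ W) (subset_closure
        (Finset.mem_coe.mpr (Finset.mem_image_of_mem w (Finset.mk_mem_sym2_iff.mpr ⟨ha, hb⟩))))
      exact (mul_mem_cancel_right h1).mp ((le_sup_left : _ ≤ W) (hzm _ _))
    have hmk : s((s(a, b)).out.1, (s(a, b)).out.2) = s(a, b) := Quot.out_eq _
    rcases Sym2.eq_iff.mp hmk with ⟨h1, h2⟩ | ⟨h1, h2⟩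
    · rwa [h1, h2] at hout
    · rw [h1, h2] at hout
      rw [← commutatorElement_inv]
      exact inv_mem hout
  have hGW : _root_.commutator G ≤ W := by
    rw [← Normal.quotient_commutative_iff_commutator_le]
    have htop : closure (QuotientGroup.mk' W '' (S : Set G)) = ⊤ := by
      rw [← MonoidHom.map_closure, hcl, map_top_of_surjective _ (QuotientGroup.mk'_surjective W)]
    have := isMulCommutative_closure (k := QuotientGroup.mk' W '' (S : Set G)) (by
      rintro _ ⟨a, ha, rfl⟩ _ ⟨b, hb, rfl⟩
      rw [← commutatorElement_eq_one_iff_mul_comm, ← map_commutatorElement]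
      exact (QuotientGroup.eq_one_iff _).mpr (hcomm a ha b hb))
    rw [htop] at this
    exact ⟨⟨fun a b => congrArg Subtype.val (mul_comm' (⟨a, mem_top a⟩ : (⊤ : Subgroup (G ⧸ W)))
      ⟨b, mem_top b⟩)⟩⟩
  have hf := QuotientGroup.mk'_surjective (closure (T : Set G))
  have h := map_mono (f := QuotientGroup.mk' (closure (T : Set G))) hGW
  rwa [_root_.commutator_def, map_commutator, map_top_of_surjective _ hf, hW, Subgroup.map_sup,
    map_powSubgroup hf, QuotientGroup.map_mk'_self, sup_bot_eq] at h

theorem rank_subgroup_bound (p : ℕ) (hp : p.Prime) (hodd : Odd p)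
    (G : Type*) [Group G] [Finite G]
    (hG : IsPGroup p G) (hQP : IsQuasiPowerful p G) (r : ℕ) (hr : Group.rank G = r)
    (H : Subgroup G) : Group.rank H ≤ r * (r + 3) / 2 := by
  obtain ⟨N, hN, hNc, hNr, hpow⟩ := hQP.exists_le_center
  let f : H →* G ⧸ N := (QuotientGroup.mk' N).comp H.subtype
  have hrange : Group.rank f.range ≤ r :=
    (hpow.rank_subgroup_le hp hodd (hG.to_quotient N) f.range).trans
      (hr ▸ Group.rank_le_of_surjective _ (QuotientGroup.mk'_surjective N))
  have hker : Group.rank f.ker ≤ (r + 1).choose 2 := by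
    have hmem : ∀ x : f.ker, H.subtype x ∈ N := fun x => (QuotientGroup.eq_one_iff _).mp x.2
    let g : f.ker →* N := (H.subtype.comp f.ker.subtype).codRestrict N hmem
    have hg : Function.Injective g := fun x y hxy =>
      Subtype.ext (Subtype.ext (congrArg (Subtype.val : N → G) hxy))
    have hNcomm : IsMulCommutative N :=
      ⟨⟨fun a b => Subtype.ext (mem_center_iff.mp (hNc b.2) a)⟩⟩
    rw [Group.rank_congr (MonoidHom.ofInjective hg)]
    exact ((isPowerful_of_isMulCommutative p N).rank_subgroup_le hp hodd (hG.to_subgroup N)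
      g.range).trans (hr ▸ hNr)
  refine (rank_le_rank_range_add_rank_ker f).trans ((Nat.add_le_add hrange hker).trans ?_)
  rw [Nat.choose_two_right, Nat.add_sub_cancel, Nat.le_div_iff_mul_le two_pos]
  have := Nat.div_mul_le_self ((r + 1) * r) 2
  nlinarith
end

section
/- Let p be an odd prime and let G be a quasi-powerful p-group. Then the subgroup H = G^p · Z(G) is powerfully embedded in G; that is, [H, G] is contained in the subgroup generated by the p-th powers of elements of H. -/
section

open scoped commutatorElement

variable {G : Type*} [Group G]

theorem commutatorElement_pow_left_eq {x y : G} (h : ⁅x, ⁅x, y⁆⁆ ∈ Subgroup.center G) (n : ℕ) :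
    ⁅x ^ n, y⁆ = ⁅x, y⁆ ^ n * ⁅x, ⁅x, y⁆⁆ ^ (n.choose 2) := by
  set c := ⁅x, y⁆ with hc
  set d := ⁅x, c⁆ with hd
  have hdc : ∀ g, Commute d g := fun g => (Subgroup.mem_center_iff.mp h g).symm
  have hconj : x * c * x⁻¹ = c * d := by
    rw [← (hdc c).eq, hd, commutatorElement_def]
    group
  induction n with
  | zero => simp
  | succ n ih =>
    have hstep : ⁅x ^ (n + 1), y⁆ = x * ⁅x ^ n, y⁆ * x⁻¹ * c := by
      rw [hc, commutatorElement_def, commutatorElement_def, commutatorElement_def, pow_succ']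
      group
    have hpow : x * c ^ n * x⁻¹ = c ^ n * d ^ n := by
      rw [← conj_pow, hconj, (hdc c).symm.mul_pow]
    have hk : x * d ^ n.choose 2 * x⁻¹ = d ^ n.choose 2 := by
      rw [← ((hdc x).pow_left _).eq, mul_inv_cancel_right]
    have hchoose : (n + 1).choose 2 = n + n.choose 2 := by
      rw [Nat.choose_succ_succ' n 1, Nat.choose_one_right]
    calc ⁅x ^ (n + 1), y⁆ = x * c ^ n * x⁻¹ * (x * d ^ n.choose 2 * x⁻¹) * c := by
          rw [hstep, ih]; group
      _ = c ^ n * (d ^ (n + n.choose 2) * c) := by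
          rw [hpow, hk, pow_add]; simp only [mul_assoc]
      _ = c ^ (n + 1) * d ^ (n + 1).choose 2 := by
          rw [((hdc c).pow_left _).eq, hchoose, pow_succ c, mul_assoc]

theorem commutatorElement_pow_left_eq_one {p : ℕ} (hodd : Odd p) {x y : G}
    (h : ⁅x, ⁅x, y⁆⁆ ∈ Subgroup.center G) (hc : ⁅x, y⁆ ^ p = 1) (hd : ⁅x, ⁅x, y⁆⁆ ^ p = 1) :
    ⁅x ^ p, y⁆ = 1 := by
  obtain ⟨m, rfl⟩ := hodd
  have hchoose : (2 * m + 1).choose 2 = (2 * m + 1) * m := by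
    rw [Nat.choose_two_right, Nat.add_sub_cancel, Nat.mul_left_comm,
      Nat.mul_div_cancel_left _ two_pos]
  rw [commutatorElement_pow_left_eq h, hc, hchoose, pow_mul, hd, one_pow, one_mul]

namespace Subgroup

theorem le_of_le_sup_commutator_top [Group.IsNilpotent G] {M N : Subgroup G} [N.Normal]
    (h : M ≤ N ⊔ ⁅M, ⊤⁆) : M ≤ N := by
  have key : ∀ n, M ≤ N ⊔ lowerCentralSeries (⊤ : Subgroup G) n := by
    intro n
    induction n with
    | zero => simp
    | succ n ih =>
      refine h.trans (sup_le le_sup_left (commutator_le.mpr fun a ha g hg => ?_))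
      obtain ⟨b, hb, l, hl, rfl⟩ := mem_sup_of_normal_left.mp (ih ha)
      have hlg : ⁅l, g⁆ ∈ N ⊔ lowerCentralSeries (⊤ : Subgroup G) (n + 1) :=
        mem_sup_right (commutator_mem_commutator hl hg)
      have hbg : ⁅b, g⁆ ∈ N ⊔ lowerCentralSeries (⊤ : Subgroup G) (n + 1) :=
        mem_sup_left (commutator_le_left N ⊤ (commutator_mem_commutator hb hg))
      have hmul : ⁅b * l, g⁆ = b * ⁅l, g⁆ * b⁻¹ * ⁅b, g⁆ := by
        simp only [commutatorElement_def]
        group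
      rw [hmul]
      exact mul_mem (Normal.conj_mem inferInstance _ hlg b) hbg
  obtain ⟨n, hn⟩ := (isNilpotent_iff_lowerCentralSeries (S := (⊤ : Subgroup G))).mp inferInstance
  simpa [hn] using key n

theorem closure_normal_of_conj_mem {s : Set G} (h : ∀ x ∈ s, ∀ g, g * x * g⁻¹ ∈ s) :
    (closure s).Normal :=
  ⟨fun _ hn g => (closure_le ((closure s).comap (MulAut.conj g).toMonoidHom)).mpr
    (fun x hx => subset_closure (h x hx g)) hn⟩

theorem commutator_top_le_of_le_comap_center {H K : Subgroup G} [K.Normal]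
    (h : H ≤ (center (G ⧸ K)).comap (QuotientGroup.mk' K)) : ⁅H, ⊤⁆ ≤ K := by
  refine commutator_le.mpr fun a ha g _ => ?_
  rw [← QuotientGroup.eq_one_iff, ← QuotientGroup.mk'_apply, map_commutatorElement,
    commutatorElement_eq_one_iff_mul_comm]
  exact (mem_center_iff.mp (h ha) _).symm

end Subgroup

instance powSubgroup_normal (n : ℕ) : (powSubgroup G n).Normal :=
  Subgroup.closure_normal_of_conj_mem <| by
    rintro _ ⟨x, rfl⟩ g
    exact ⟨g * x * g⁻¹, conj_pow⟩

theorem IsQuasiPowerful.commutator_le {p : ℕ} (h : IsQuasiPowerful p G) :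
    commutator G ≤ powSubgroup G p ⊔ Subgroup.center G := by
  have hle : powSubgroup (G ⧸ Subgroup.center G) p ≤
      (powSubgroup G p).map (QuotientGroup.mk' (Subgroup.center G)) := by
    refine (Subgroup.closure_le _).mpr ?_
    rintro _ ⟨g, rfl⟩
    obtain ⟨g, rfl⟩ := QuotientGroup.mk'_surjective _ g
    exact ⟨g ^ p, Subgroup.subset_closure ⟨g, rfl⟩, map_pow _ _ _⟩
  have hcomap := Subgroup.comap_map_eq (QuotientGroup.mk' (Subgroup.center G)) (powSubgroup G p)
  rw [QuotientGroup.ker_mk'] at hcomap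
  rw [← hcomap, ← Subgroup.map_le_iff_le_comap, commutator_def, Subgroup.map_commutator]
  exact (Subgroup.commutator_mono le_top le_top).trans (le_trans h hle)

end

theorem H_powerfully_embedded (p : ℕ) (hp : p.Prime) (hodd : Odd p)
    (G : Type*) [Group G] [Finite G]
    (hG : IsPGroup p G) (hQP : IsQuasiPowerful p G) :
    ⁅powSubgroup G p ⊔ Subgroup.center G, (⊤ : Subgroup G)⁆ ≤
      Subgroup.closure {x : G | ∃ h ∈ powSubgroup G p ⊔ Subgroup.center G, h ^ p = x} := by
  open scoped commutatorElement in
  have : Fact p.Prime := ⟨hp⟩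
  have : Group.IsNilpotent G := hG.isNilpotent
  set H := powSubgroup G p ⊔ Subgroup.center G
  set N := Subgroup.closure {x : G | ∃ h ∈ H, h ^ p = x}
  have : N.Normal := Subgroup.closure_normal_of_conj_mem <| by
    rintro _ ⟨h, hh, rfl⟩ g
    exact ⟨g * h * g⁻¹, Subgroup.Normal.conj_mem inferInstance h hh g, conj_pow⟩
  refine Subgroup.le_of_le_sup_commutator_top ?_
  set K := N ⊔ ⁅⁅H, (⊤ : Subgroup G)⁆, (⊤ : Subgroup G)⁆
  have hcomm : ∀ x y : G, ⁅x, y⁆ ∈ H := fun x y =>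
    hQP.commutator_le (Subgroup.commutator_mem_commutator trivial trivial)
  have hpow : ∀ h ∈ H, (QuotientGroup.mk' K h) ^ p = 1 := fun h hh => by
    rw [← map_pow, QuotientGroup.mk'_apply, QuotientGroup.eq_one_iff]
    exact le_sup_left (a := N) (Subgroup.subset_closure ⟨h, hh, rfl⟩)
  refine Subgroup.commutator_top_le_of_le_comap_center (sup_le ?_ fun z hz => ?_)
  · refine (Subgroup.closure_le _).mpr ?_
    rintro _ ⟨x, rfl⟩
    refine Subgroup.mem_center_iff.mpr fun y => ?_
    obtain ⟨y, rfl⟩ := QuotientGroup.mk'_surjective _ y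
    rw [eq_comm, ← commutatorElement_eq_one_iff_mul_comm, map_pow]
    refine commutatorElement_pow_left_eq_one hodd (Subgroup.mem_center_iff.mpr fun w => ?_) ?_ ?_
    · obtain ⟨w, rfl⟩ := QuotientGroup.mk'_surjective _ w
      rw [eq_comm, ← commutatorElement_eq_one_iff_mul_comm]
      simp only [← map_commutatorElement]
      rw [QuotientGroup.mk'_apply, QuotientGroup.eq_one_iff]
      have hd : ⁅x, ⁅x, y⁆⁆ ∈ ⁅H, (⊤ : Subgroup G)⁆ := by
        rw [Subgroup.commutator_comm]
        exact Subgroup.commutator_mem_commutator trivial (hcomm x y)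
      exact le_sup_right (a := N) (Subgroup.commutator_mem_commutator hd trivial)
    · rw [← map_commutatorElement]
      exact hpow _ (hcomm x y)
    · simp only [← map_commutatorElement]
      exact hpow _ (hcomm x _)
  · refine Subgroup.mem_center_iff.mpr fun y => ?_
    obtain ⟨y, rfl⟩ := QuotientGroup.mk'_surjective _ y
    rw [← map_mul, ← map_mul, Subgroup.mem_center_iff.mp hz y]
end
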